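/- arXiv:math/0203084 — 10 statements merged into one kernel-verified Lean document; each statement's English description precedes it below -/
import Mathlib

section
/- Let T be a type and m an associative Maltsev operation on T. Then for all u, v, x, y, z ∈ T one has m u v (m x y z) = m u (m y x v) z. -/
/-- A Maltsev operation `m` on `T` satisfies `m x y y = x` and `m y y x = x`;
it is associative if `m u v (m x y z) = m (m u v x) y z`. -/
theorem maltsev_assoc_middle {T : Type*} (m : T → T → T → T)
    (hml : ∀ x y : T, m x y y = x)
    (hmr : ∀ x y : T, m y y x = x)
    (hassoc : ∀ u v x y z : T, m u v (m x y z) = m (m u v x) y z) :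
    ∀ u v x y z : T, m u v (m x y z) = m u (m y x v) z := by
  intro u v x y z
  have key : m u v x = m u (m y x v) y := by
    have hu : m (m u (m y x v) y) x v = u := by rw [← hassoc, hml]
    calc m u v x = m (m (m u (m y x v) y) x v) v x := by rw [hu]
      _ = m u (m y x v) y := by rw [← hassoc, hmr, hml]
  rw [hassoc, key, ← hassoc, hmr]
end

section
/- Let m be an associative Maltsev operation on a type T. Then the relation on T × T defined by (x, y) ~ (x', y') if and only if x' = m x y y' is an equivalence relation on T × T. -/
/-- For an associative Maltsev operation `m` on `T`, the relation on `T × T` given by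
`(x, y) ~ (x', y') ↔ x' = m x y y'` is an equivalence relation. -/
theorem maltsev_rel_equivalence {T : Type*} (m : T → T → T → T)
    (hml : ∀ x y : T, m x y y = x)
    (hmr : ∀ x y : T, m y y x = x)
    (hassoc : ∀ u v x y z : T, m u v (m x y z) = m (m u v x) y z) :
    Equivalence (fun p q : T × T => q.1 = m p.1 p.2 q.2) := by
  refine ⟨fun p => (hml p.1 p.2).symm, ?_, ?_⟩
  · rintro ⟨x, y⟩ ⟨x', y'⟩ h
    simp only at h ⊢
    rw [h, ← hassoc, hmr, hml]
  · rintro ⟨x, y⟩ ⟨x', y'⟩ ⟨x'', y''⟩ h h'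
    simp only at h h' ⊢
    rw [h', h, ← hassoc, hmr]
end

section
/- Let m be an associative Maltsev operation on a type T, and let ~ be the relation on T × T defined by (x, y) ~ (x', y') iff x' = m x y y'. If (x, y) ~ (x', y') and (z, t) ~ (z', t'), then (m x y z, t) ~ (m x' y' z', t'); that is, m x' y' z' = m (m x y z) t t'. -/
/-- For an associative Maltsev operation `m` on `T` and the relation
`(x, y) ~ (x', y') ↔ x' = m x y y'` on `T × T`: if `(x, y) ~ (x', y')` and
`(z, t) ~ (z', t')` then `(m x y z, t) ~ (m x' y' z', t')`,
i.e. `m x' y' z' = m (m x y z) t t'`. -/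
theorem maltsev_rel_compatible {T : Type*} (m : T → T → T → T)
    (hml : ∀ x y : T, m x y y = x)
    (hmr : ∀ x y : T, m y y x = x)
    (hassoc : ∀ u v x y z : T, m u v (m x y z) = m (m u v x) y z)
    (x y x' y' z t z' t' : T)
    (h1 : x' = m x y y') (h2 : z' = m z t t') :
    m x' y' z' = m (m x y z) t t' := by
  rw [h1, h2, hassoc, ← hassoc x y y' y' z, hmr]
end

section
/- Let T be a nonempty type and m an associative Maltsev operation on T. Then there exist a group G and a simply transitive action of G on T such that m x y z = (x − y) • z for all x, y, z ∈ T, where x − y denotes the unique g ∈ G with g • y = x. If moreover m is commutative, then G can be chosen to be commutative. -/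
universe u

/-- The group on `T` with unit `e` and multiplication `a * b = m a e b`, for an associative
Maltsev operation `m`. -/
abbrev groupOfMaltsev {T : Type u} (m : T → T → T → T)
    (hml : ∀ x y : T, m x y y = x)
    (hmr : ∀ x y : T, m y y x = x)
    (hassoc : ∀ u v x y z : T, m u v (m x y z) = m (m u v x) y z) (e : T) : Group T :=
  letI : Mul T := ⟨fun a b => m a e b⟩
  letI : One T := ⟨e⟩
  letI : Inv T := ⟨fun a => m e a e⟩
  Group.ofLeftAxioms (fun a b c => (hassoc a e b e c).symm) (fun a => hmr a e) fun a =>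
    show m (m e a e) e a = e by rw [← hassoc, hmr, hml]

/-- Left translations `y ↦ m g e y` act simply transitively, and `m x y z` is the value at `z`
of the translation taking `y` to `x`. -/
theorem maltsev_translation {T : Type u} {m : T → T → T → T}
    (hml : ∀ x y : T, m x y y = x)
    (hmr : ∀ x y : T, m y y x = x)
    (hassoc : ∀ u v x y z : T, m u v (m x y z) = m (m u v x) y z) (e : T) :
    (∀ x y : T, ∃! g : T, m g e y = x) ∧
      (∀ x y z g : T, m g e y = x → m x y z = m g e z) := by
  have translate : ∀ x y z g : T, m g e y = x → m x y z = m g e z := by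
    rintro _ y z g rfl
    rw [← hassoc, hmr]
  refine ⟨fun x y => ⟨m x y e, ?_, fun g hg => ?_⟩, translate⟩
  · show m (m x y e) e y = x
    rw [← hassoc, hmr, hml]
  · rw [translate x y e g hg, hml]

/-- Any associative Maltsev operation on a nonempty type `T` arises as
`m x y z = (x - y) • z` from a simply transitive action of some group `G` on `T`;
if `m` is commutative, `G` can be chosen commutative. -/
theorem exists_group_of_maltsev {T : Type u} [Nonempty T] (m : T → T → T → T)
    (hml : ∀ x y : T, m x y y = x)
    (hmr : ∀ x y : T, m y y x = x)
    (hassoc : ∀ u v x y z : T, m u v (m x y z) = m (m u v x) y z) :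
    (∃ (G : Type u) (_ : Group G) (_ : MulAction G T),
      (∀ x y : T, ∃! g : G, g • y = x) ∧
      (∀ (x y z : T) (g : G), g • y = x → m x y z = g • z)) ∧
    ((∀ x y z : T, m x y z = m z y x) →
      ∃ (G : Type u) (_ : CommGroup G) (_ : MulAction G T),
        (∀ x y : T, ∃! g : G, g • y = x) ∧
        (∀ (x y z : T) (g : G), g • y = x → m x y z = g • z)) := by
  obtain ⟨e⟩ := ‹Nonempty T›
  let G : Group T := groupOfMaltsev m hml hmr hassoc e
  refine ⟨⟨T, G, Monoid.toMulAction T, maltsev_translation hml hmr hassoc e⟩, fun hcomm => ?_⟩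
  let A : CommGroup T := { G with mul_comm := fun a b => hcomm a e b }
  exact ⟨T, A, Monoid.toMulAction T, maltsev_translation hml hmr hassoc e⟩
end

section
/- Let E be a nonempty type, B a type, p : E → B a function, and suppose given elements m x y z ∈ E defined for all x, y, z ∈ E with p x = p y, satisfying: p (m x y z) = p z whenever p x = p y; m x y y = x whenever p x = p y; m y y z = z for all y, z ∈ E; and m u v (m x y z) = m (m u v x) y z whenever p u = p v and p x = p y. Then there exist a group G and an action of G on E satisfying p(g • e) = p(e) for all g ∈ G, e ∈ E, which is simply transitive on each fiber (for all e, e' ∈ E with p e = p e' there is a unique g ∈ G with g • e' = e), and such that m x y z = (x − y) • z whenever p x = p y, where x − y denotes the unique g ∈ G with g • y = x. -/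
universe u v

/-- Translation `z ↦ m x y z` by two points of the same fiber, with inverse `z ↦ m y x z`. -/
def maltsevPerm {E : Type u} {B : Type v} (p : E → B) (m : E → E → E → E)
    (h1 : ∀ x y : E, p x = p y → m x y y = x)
    (h2 : ∀ y z : E, m y y z = z)
    (h3 : ∀ u v x y z : E, p u = p v → p x = p y → m u v (m x y z) = m (m u v x) y z)
    (x y : E) (hxy : p x = p y) : Equiv.Perm E where
  toFun := m x y
  invFun := m y x
  left_inv z := by rw [h3 y x x y z hxy.symm hxy, h1 y x hxy.symm, h2]
  right_inv z := by rw [h3 x y y x z hxy hxy.symm, h1 x y hxy, h2]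

/-- The group of fiber-preserving permutations `σ` satisfying `σ z = m (σ y) y z`. -/
def maltsevSubgroup {E : Type u} {B : Type v} (p : E → B) (m : E → E → E → E)
    (h1 : ∀ x y : E, p x = p y → m x y y = x)
    (h2 : ∀ y z : E, m y y z = z)
    (h3 : ∀ u v x y z : E, p u = p v → p x = p y → m u v (m x y z) = m (m u v x) y z) :
    Subgroup (Equiv.Perm E) where
  carrier := {σ | (∀ y, p (σ y) = p y) ∧ ∀ y z, σ z = m (σ y) y z}
  one_mem' := ⟨fun _ => rfl, fun y z => (h2 y z).symm⟩
  mul_mem' := by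
    rintro σ τ ⟨hσ, hσm⟩ ⟨hτ, hτm⟩
    refine ⟨fun y => (hσ (τ y)).trans (hτ y), fun y z => ?_⟩
    change σ (τ z) = m (σ (τ y)) y z
    rw [hσm (τ y) (τ z), hτm y z, h3 _ _ _ _ _ (hσ _) (hτ _), h1 _ _ (hσ _)]
  inv_mem' := by
    rintro σ ⟨hσ, hσm⟩
    have hs : ∀ y, σ (σ⁻¹ y) = y := σ.apply_symm_apply
    have hinv : ∀ y, p (σ⁻¹ y) = p y := fun y => by
      rw [← hσ (σ⁻¹ y), hs]
    refine ⟨hinv, fun y z => σ.injective ?_⟩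
    rw [hs, hσm (σ⁻¹ y) (m (σ⁻¹ y) y z), hs,
      h3 _ _ _ _ _ (hinv y).symm (hinv y), h1 _ _ (hinv y).symm, h2]

/-- Given `p : E → B` with `E` nonempty and a fiberwise associative Maltsev operation
`m` over `p`, there is a group `G` acting on `E`, preserving `p`, simply transitively
on each fiber, such that `m x y z = (x - y) • z` whenever `p x = p y`, where `x - y`
is the unique `g` with `g • y = x`. -/
theorem exists_fiberwise_group_of_maltsev {E : Type u} [Nonempty E] {B : Type v}
    (p : E → B) (m : E → E → E → E)
    (h0 : ∀ x y z : E, p x = p y → p (m x y z) = p z)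
    (h1 : ∀ x y : E, p x = p y → m x y y = x)
    (h2 : ∀ y z : E, m y y z = z)
    (h3 : ∀ u v x y z : E, p u = p v → p x = p y →
      m u v (m x y z) = m (m u v x) y z) :
    ∃ (G : Type (max u v)) (_ : Group G) (_ : MulAction G E),
      (∀ (g : G) (e : E), p (g • e) = p e) ∧
      (∀ e e' : E, p e = p e' → ∃! g : G, g • e' = e) ∧
      (∀ x y z : E, p x = p y → ∀ g : G, g • y = x → m x y z = g • z) := by
  refine ⟨ULift.{max u v} (maltsevSubgroup p m h1 h2 h3), inferInstance, inferInstance,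
    fun g e => g.down.2.1 e, fun e e' he => ?_, ?_⟩
  · refine ⟨⟨⟨maltsevPerm p m h1 h2 h3 e e' he, fun z => h0 e e' z he, fun y z => ?_⟩⟩,
      h1 e e' he, fun g hg => ?_⟩
    · change m e e' z = m (m e e' y) y z
      rw [← h3 e e' y y z he rfl, h2]
    · refine ULift.ext _ _ (Subtype.ext (Equiv.ext fun z => ?_))
      change g.down.1 e' = e at hg
      change g.down.1 z = m e e' z
      rw [g.down.2.2 e' z, hg]
  · rintro x y z - g rfl
    exact (g.down.2.2 y z).symm
end

section
/- Let M be a type, R and S equivalence relations on M, and p a Maltsev operation on M. Let m : M → M → M → M satisfy: m x y y = x whenever R x y; m y y z = z whenever S y z; and the homomorphism law: for all x₁, x₂, x₃, y₁, y₂, y₃, z₁, z₂, z₃ ∈ M with R xᵢ yᵢ and S yᵢ zᵢ for i = 1, 2, 3, one has m (p x₁ x₂ x₃) (p y₁ y₂ y₃) (p z₁ z₂ z₃) = p (m x₁ y₁ z₁) (m x₂ y₂ z₂) (m x₃ y₃ z₃). Then m x y z = p x y z for all x, y, z ∈ M with R x y and S y z. -/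
/-- If `R`, `S` are equivalence relations on `M`, `p` is a Maltsev operation, and
`m` satisfies the Maltsev laws relative to `R`, `S` together with the homomorphism
law with respect to `p`, then `m` coincides with `p` on triples `x R y S z`. -/
theorem maltsev_hom_eq_p {M : Type*} (R S : M → M → Prop)
    (hR : Equivalence R) (hS : Equivalence S)
    (p : M → M → M → M)
    (hpl : ∀ x y : M, p x y y = x)
    (hpr : ∀ x y : M, p y y x = x)
    (m : M → M → M → M)
    (hml : ∀ x y : M, R x y → m x y y = x)
    (hmr : ∀ y z : M, S y z → m y y z = z)
    (hhom : ∀ x₁ x₂ x₃ y₁ y₂ y₃ z₁ z₂ z₃ : M,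
      R x₁ y₁ → R x₂ y₂ → R x₃ y₃ → S y₁ z₁ → S y₂ z₂ → S y₃ z₃ →
      m (p x₁ x₂ x₃) (p y₁ y₂ y₃) (p z₁ z₂ z₃)
        = p (m x₁ y₁ z₁) (m x₂ y₂ z₂) (m x₃ y₃ z₃)) :
    ∀ x y z : M, R x y → S y z → m x y z = p x y z := by
  intro x y z hxy hyz
  have h := hhom x y y y y y y y z hxy (hR.refl y) (hR.refl y) (hS.refl y) (hS.refl y) hyz
  rwa [hpl x y, hpl y y, hpr z y, hml x y hxy, hml y y (hR.refl y), hmr y z hyz] at h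
end

section
/- Let M be a type, R and S equivalence relations on M, and p a Maltsev operation on M which is compatible with R and S (if R xᵢ yᵢ for i = 1, 2, 3 then R (p x₁ x₂ x₃) (p y₁ y₂ y₃), and similarly for S). Suppose there exists m : M → M → M → M satisfying: m x y y = x whenever R x y; m y y z = z whenever S y z; and the homomorphism law: for all xᵢ, yᵢ, zᵢ (i = 1, 2, 3) with R xᵢ yᵢ and S yᵢ zᵢ, m (p x₁ x₂ x₃) (p y₁ y₂ y₃) (p z₁ z₂ z₃) = p (m x₁ y₁ z₁) (m x₂ y₂ z₂) (m x₃ y₃ z₃). Then p u v (p x y z) = p (p u v x) y z whenever R u v, S y z, and either S v x or R x y. -/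
/-- If `R`, `S` are equivalence relations on `M` compatible with a Maltsev operation
`p`, and some `m` satisfies the relative Maltsev laws and the homomorphism law, then
`p u v (p x y z) = p (p u v x) y z` whenever `R u v`, `S y z` and either `S v x` or
`R x y`. -/
theorem maltsev_restricted_assoc {M : Type*} (R S : M → M → Prop)
    (hR : Equivalence R) (hS : Equivalence S)
    (p : M → M → M → M)
    (hpl : ∀ x y : M, p x y y = x)
    (hpr : ∀ x y : M, p y y x = x)
    (hRcompat : ∀ x₁ x₂ x₃ y₁ y₂ y₃ : M, R x₁ y₁ → R x₂ y₂ → R x₃ y₃ →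
      R (p x₁ x₂ x₃) (p y₁ y₂ y₃))
    (hScompat : ∀ x₁ x₂ x₃ y₁ y₂ y₃ : M, S x₁ y₁ → S x₂ y₂ → S x₃ y₃ →
      S (p x₁ x₂ x₃) (p y₁ y₂ y₃))
    (m : M → M → M → M)
    (hml : ∀ x y : M, R x y → m x y y = x)
    (hmr : ∀ y z : M, S y z → m y y z = z)
    (hhom : ∀ x₁ x₂ x₃ y₁ y₂ y₃ z₁ z₂ z₃ : M,
      R x₁ y₁ → R x₂ y₂ → R x₃ y₃ → S y₁ z₁ → S y₂ z₂ → S y₃ z₃ →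
      m (p x₁ x₂ x₃) (p y₁ y₂ y₃) (p z₁ z₂ z₃)
        = p (m x₁ y₁ z₁) (m x₂ y₂ z₂) (m x₃ y₃ z₃)) :
    ∀ u v x y z : M, R u v → S y z → (S v x ∨ R x y) →
      p u v (p x y z) = p (p u v x) y z := by
  have hmp : ∀ x y z : M, R x y → S y z → m x y z = p x y z := by
    intro x y z hxy hyz
    have h := hhom x y y y y y y y z hxy (hR.refl y) (hR.refl y) (hS.refl y) (hS.refl y) hyz
    rwa [hpl, hpl, hpr, hml x y hxy, hml y y (hR.refl y), hmr y z hyz] at h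
  rintro u v x y z huv hyz (hvx | hxy)
  · have hS_v : S v (p x y z) := by
      have h := hScompat x y y x y z (hS.refl x) (hS.refl y) hyz
      rw [hpl] at h
      exact hS.trans hvx h
    have h := hhom u y y v y y x y z huv (hR.refl y) (hR.refl y) hvx (hS.refl y) hyz
    rwa [hpl, hpl, hmp u v _ huv hS_v, hmp u v x huv hvx, hml y y (hR.refl y),
      hmr y z hyz] at h
  · have hR_y : R (p u v x) y := by
      have h := hRcompat u v x v v x huv (hR.refl v) (hR.refl x)
      rw [hpr x v] at h
      exact hR.trans h hxy
    have h := hhom u v x v v y v v z huv (hR.refl v) hxy (hS.refl v) (hS.refl v) hyz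
    rw [hpr y v, hpr z v, hmp _ y z hR_y hyz, hml u v huv, hml v v (hR.refl v),
      hmp x y z hxy hyz] at h
    exact h.symm
end

section
/- Let M be a type, R and S equivalence relations on M, and p a Maltsev operation on M. Suppose there exists m : M → M → M → M satisfying: m x y y = x whenever R x y; m y y z = z whenever S y z; and the homomorphism law: for all xᵢ, yᵢ, zᵢ (i = 1, 2, 3) with R xᵢ yᵢ and S yᵢ zᵢ, m (p x₁ x₂ x₃) (p y₁ y₂ y₃) (p z₁ z₂ z₃) = p (m x₁ y₁ z₁) (m x₂ y₂ z₂) (m x₃ y₃ z₃). Then p x y z = p z y x for all x, y, z ∈ M with R x y and S y z. -/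
/-- If `R`, `S` are equivalence relations on `M`, `p` is a Maltsev operation, and
some `m` satisfies the relative Maltsev laws and the homomorphism law, then
`p x y z = p z y x` whenever `R x y` and `S y z`. -/
theorem maltsev_restricted_comm {M : Type*} (R S : M → M → Prop)
    (hR : Equivalence R) (hS : Equivalence S)
    (p : M → M → M → M)
    (hpl : ∀ x y : M, p x y y = x)
    (hpr : ∀ x y : M, p y y x = x)
    (m : M → M → M → M)
    (hml : ∀ x y : M, R x y → m x y y = x)
    (hmr : ∀ y z : M, S y z → m y y z = z)
    (hhom : ∀ x₁ x₂ x₃ y₁ y₂ y₃ z₁ z₂ z₃ : M,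
      R x₁ y₁ → R x₂ y₂ → R x₃ y₃ → S y₁ z₁ → S y₂ z₂ → S y₃ z₃ →
      m (p x₁ x₂ x₃) (p y₁ y₂ y₃) (p z₁ z₂ z₃)
        = p (m x₁ y₁ z₁) (m x₂ y₂ z₂) (m x₃ y₃ z₃)) :
    ∀ x y z : M, R x y → S y z → p x y z = p z y x := by
  intro x y z hxy hyz
  have h₁ := hhom x y y y y y y y z hxy (hR.refl y) (hR.refl y) (hS.refl y) (hS.refl y) hyz
  have h₂ := hhom y y x y y y z y y (hR.refl y) (hR.refl y) hxy hyz (hS.refl y) (hS.refl y)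
  simp only [hpl, hpr, hml x y hxy, hmr y z hyz, hml y y (hR.refl y)] at h₁ h₂
  exact h₁.symm.trans h₂
end

section
/- Let C be a category equipped with, for every pair of objects X, Y, a function m : Hom(X,Y) × Hom(X,Y) × Hom(X,Y) → Hom(X,Y) satisfying m f g g = f and m g g f = f for all f, g ∈ Hom(X,Y), and compatible with composition: for all objects X, Y, Z, all f, g, h : Y → Z and all f', g', h' : X → Y, (m f g h) ∘ (m f' g' h') = m (f ∘ f') (g ∘ g') (h ∘ h'). Then every endomorphism monoid of C is commutative: for every object X and all e, e' : X → X, e ∘ e' = e' ∘ e. -/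
open CategoryTheory

universe v u

/-- A category equipped with a functorial Maltsev operation on all hom-sets has
commutative endomorphism monoids. -/
theorem endomorphisms_comm_of_functorial_maltsev {C : Type u} [Category.{v} C]
    (m : ∀ {X Y : C}, (X ⟶ Y) → (X ⟶ Y) → (X ⟶ Y) → (X ⟶ Y))
    (hml : ∀ {X Y : C} (f g : X ⟶ Y), m f g g = f)
    (hmr : ∀ {X Y : C} (f g : X ⟶ Y), m g g f = f)
    (hcomp : ∀ {X Y Z : C} (f g h : Y ⟶ Z) (f' g' h' : X ⟶ Y),
      m f' g' h' ≫ m f g h = m (f' ≫ f) (g' ≫ g) (h' ≫ h)) :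
    ∀ (X : C) (e e' : X ⟶ X), e ≫ e' = e' ≫ e := by
  intro X e e'
  have h₁ := hcomp (𝟙 X) (𝟙 X) e' e (𝟙 X) (𝟙 X)
  have h₂ := hcomp e (𝟙 X) (𝟙 X) (𝟙 X) (𝟙 X) e'
  simp only [hml, hmr, Category.comp_id, Category.id_comp] at h₁ h₂
  exact h₁.trans h₂.symm
end

section
/- Let ∂ : M → R be a left linear form, N and N' left R-modules, f : M → N and f' : M → N' R-linear maps; equip N and N' with the operations a +_b c = a − b + c, r_a b = (1−r)•a + r•b, and φ_a(x) = f(x) + (1 − ∂x)•a (respectively φ'_a(x) = f'(x) + (1 − ∂x)•a on N'). For a function h : N' → N, the following are equivalent: (1) h preserves the operations, i.e. h(a +_b c) = h(a) +_{h(b)} h(c), h(r_a b) = r_{h(a)} h(b), and h(φ'_a(x)) = φ_{h(a)}(x) for all a, b, c ∈ N', r ∈ R, x ∈ M; (2) there exist an R-linear map g : N' → N and an element n ∈ N with f(x) − g(f'(x)) = (∂x)•n for all x ∈ M, such that h(y) = g(y) + n for all y ∈ N'. Moreover, in case (2) the pair (g, n) is uniquely determined: n = h(0) and g(y) = h(y)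 − h(0). -/
/-- The herd operation `b +_a c := b - a + c` on an additive group. -/
def triOp {N : Type*} [AddCommGroup N] (b a c : N) : N := b - a + c

/-- The operation `r_a b := (1 - r) • a + r • b` on a module. -/
def scOp {R N : Type*} [Ring R] [AddCommGroup N] [Module R N] (r : R) (a b : N) : N :=
  (1 - r) • a + r • b

/-- The operation `φ_a x := f x + (1 - ∂ x) • a` associated to a linear form
`∂ : M → R` and a linear map `f : M → N`. -/
def phiOp {R M N : Type*} [Ring R] [AddCommGroup M] [Module R M]
    [AddCommGroup N] [Module R N] (f : M →ₗ[R] N) (d : M →ₗ[R] R) (a : N) (x : M) : N :=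
  f x + (1 - d x) • a

/-- For a left linear form `∂ : M → R` and `R`-linear maps `f : M → N`, `f' : M → N'`,
a function `h : N' → N` preserves the affinity operations iff it has the form
`h y = g y + n` for an `R`-linear `g : N' → N` and `n ∈ N` with
`f x - g (f' x) = (∂ x) • n` for all `x`; moreover such `(g, n)` is unique, namely
`n = h 0` and `g y = h y - h 0`. -/
theorem affinity_hom_iff {R M N N' : Type*} [Ring R]
    [AddCommGroup M] [Module R M] [AddCommGroup N] [Module R N]
    [AddCommGroup N'] [Module R N']
    (d : M →ₗ[R] R) (f : M →ₗ[R] N) (f' : M →ₗ[R] N') (h : N' → N) :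
    (((∀ a b c : N', h (triOp a b c) = triOp (h a) (h b) (h c)) ∧
      (∀ (r : R) (a b : N'), h (scOp r a b) = scOp r (h a) (h b)) ∧
      (∀ (a : N') (x : M), h (phiOp f' d a x) = phiOp f d (h a) x))
     ↔
     (∃ (g : N' →ₗ[R] N) (n : N),
        (∀ x : M, f x - g (f' x) = d x • n) ∧ (∀ y : N', h y = g y + n))) ∧
    (∀ (g : N' →ₗ[R] N) (n : N),
      (∀ x : M, f x - g (f' x) = d x • n) → (∀ y : N', h y = g y + n) →
      n = h 0 ∧ ∀ y : N', g y = h y - h 0) := by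
  refine ⟨⟨?_, ?_⟩, ?_⟩
  · rintro ⟨htri, hsc, hphi⟩
    have hadd (a c : N') : h (a + c) = h a - h 0 + h c := by
      simpa [triOp] using htri a 0 c
    have hsmul (r : R) (b : N') : h (r • b) = (1 - r) • h 0 + r • h b := by
      simpa [scOp] using hsc r 0 b
    have hf (x : M) : h (f' x) = f x + (1 - d x) • h 0 := by
      simpa [phiOp] using hphi 0 x
    let g : N' →ₗ[R] N :=
      { toFun := fun y => h y - h 0
        map_add' := fun a c => by rw [hadd]; abel
        map_smul' := fun r b => by
          rw [hsmul, RingHom.id_apply, sub_smul, one_smul, smul_sub]; abel }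
    refine ⟨g, h 0, fun x => ?_, fun y => (sub_add_cancel (h y) (h 0)).symm⟩
    change f x - (h (f' x) - h 0) = d x • h 0
    rw [hf, sub_smul, one_smul]
    abel
  · rintro ⟨g, n, hfg, hh⟩
    refine ⟨fun a b c => ?_, fun r a b => ?_, fun a x => ?_⟩
    · simp only [triOp, hh, map_add, map_sub]
      abel
    · simp only [scOp, hh, map_add, map_sub, map_smul, smul_add, sub_smul, one_smul]
      abel
    · simp only [phiOp, hh, map_add, map_sub, map_smul, smul_add, sub_smul, one_smul,
        sub_eq_iff_eq_add.mp (hfg x)]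
      abel
  · intro g n _ hh
    have hn : n = h 0 := by simp [hh]
    exact ⟨hn, fun y => by rw [← hn, hh, add_sub_cancel_right]⟩
end
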